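/- arXiv:2304.12065 — 2 statements merged into one kernel-verified Lean document; each statement's English description precedes it below -/
import Mathlib

section
/- Let $n \geq 2$ and $1 \leq k \leq n$ be integers. For any positive semi-definite symmetric $n\times n$ matrices $A, B, M_1, \dots, M_{n-k}$, the mixed discriminants satisfy $\det(A)\, D(B[k], M_1, \dots, M_{n-k}) \leq \binom{n}{k} D(A[n-k], B[k])\, D(A[k], M_1, \dots, M_{n-k})$, where $B[k]$ means $B$ repeated $k$ times. -/
/-- The mixed discriminant of `n` matrices, via the polarization
(inclusion-exclusion) formula. -/
noncomputable def mixedDisc {n : ℕ} (M : Fin n → Matrix (Fin n) (Fin n) ℝ) : ℝ :=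
  ((n.factorial : ℝ))⁻¹ *
    ∑ S : Finset (Fin n), (-1 : ℝ) ^ (n + S.card) * (∑ i ∈ S, M i).det

namespace XiaoAux

open Matrix Finset

theorem sum_bijective_eq {n : ℕ} (F : (Fin n → Fin n) → ℝ) :
    ∑ f : Fin n → Fin n, (if Function.Bijective f then F f else 0) =
      ∑ σ : Equiv.Perm (Fin n), F σ := by
  classical
  rw [← Finset.sum_filter]
  symm
  refine Finset.sum_bij (fun σ _ => (σ : Fin n → Fin n)) ?_ ?_ ?_ ?_
  · intro σ _
    exact Finset.mem_filter.2 ⟨Finset.mem_univ _, σ.bijective⟩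
  · intro a _ b _ h
    exact Equiv.coe_fn_injective h
  · intro f hf
    exact ⟨Equiv.ofBijective f (Finset.mem_filter.1 hf).2, Finset.mem_univ _, rfl⟩
  · intro σ _
    rfl

theorem incl_excl {n : ℕ} (f : Fin n → Fin n) :
    ∑ S : Finset (Fin n), (-1 : ℝ) ^ (n + S.card) * (if ∀ r, f r ∈ S then 1 else 0) =
      if Function.Bijective f then 1 else 0 := by
  classical
  have h := Finset.prod_add (fun _ : Fin n => (1 : ℝ))
    (fun i => if i ∈ Set.range f then 0 else -1) Finset.univ
  have h1 : ∏ i : Fin n, ((1 : ℝ) + (if i ∈ Set.range f then 0 else -1)) =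
      if Function.Bijective f then 1 else 0 := by
    split_ifs with hs
    all_goals rw [← Finite.surjective_iff_bijective] at hs
    · apply Finset.prod_eq_one
      intro i _
      simp [hs i, Set.mem_range]
    · simp only [Function.Surjective, not_forall] at hs
      obtain ⟨a, ha⟩ := hs
      apply Finset.prod_eq_zero (Finset.mem_univ a)
      rw [if_neg (by simpa [Set.mem_range] using ha)]
      norm_num
  rw [← h1, h, Finset.powerset_univ]
  refine Finset.sum_congr rfl fun S _ => ?_
  rw [Finset.prod_const_one, one_mul]
  split_ifs with hS
  · have : ∀ i ∈ Finset.univ \ S, (if i ∈ Set.range f then (0 : ℝ) else -1) = -1 := by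
      intro i hi
      rw [if_neg]
      rintro ⟨r, rfl⟩
      simp [hS r] at hi
    rw [Finset.prod_congr rfl this, Finset.prod_const, mul_one]
    have hc : (Finset.univ \ S).card + S.card = n := by
      rw [Finset.card_sdiff_add_card_eq_card (Finset.subset_univ S)]; simp
    have : n + S.card = (Finset.univ \ S).card + 2 * S.card := by omega
    rw [this, pow_add, pow_mul]
    simp
  · push Not at hS
    obtain ⟨r, hr⟩ := hS
    rw [mul_zero]
    symm
    apply Finset.prod_eq_zero (i := f r)
    · simp [hr]
    · simp

theorem perm_formula {n : ℕ} (M : Fin n → Matrix (Fin n) (Fin n) ℝ) :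
    (n.factorial : ℝ) * mixedDisc M =
      ∑ σ : Equiv.Perm (Fin n), Matrix.det (fun r => M (σ r) r) := by
  classical
  unfold mixedDisc
  rw [← mul_assoc, mul_inv_cancel₀ (by positivity), one_mul]
  have hd : ∀ S : Finset (Fin n), (∑ i ∈ S, M i).det =
      ∑ f : Fin n → Fin n, (if ∀ r, f r ∈ S then 1 else 0) *
        Matrix.det (fun r => M (f r) r) := by
    intro S
    have h := MultilinearMap.map_sum_finset
      (Matrix.detRowAlternating (n := Fin n) (R := ℝ)).toMultilinearMap
      (fun r i => M i r) (fun _ => S)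
    have h2 : (∑ i ∈ S, M i).det = (Matrix.detRowAlternating (n := Fin n) (R := ℝ)).toMultilinearMap
      (fun r => ∑ i ∈ S, M i r) := by
      change Matrix.det _ = Matrix.det _
      congr 1
      ext r c
      simp [Matrix.sum_apply, Finset.sum_apply]
    rw [h2, h]
    simp only [ite_mul, one_mul, zero_mul]
    rw [← Finset.sum_filter]
    apply Finset.sum_congr
    · ext f
      simp
    · intro f _
      rfl
  simp_rw [hd, Finset.mul_sum]
  rw [Finset.sum_comm, ← sum_bijective_eq (fun f => Matrix.det (fun r => M (f r) r))]
  refine Finset.sum_congr rfl fun f _ => ?_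
  simp_rw [← mul_assoc]
  rw [← Finset.sum_mul, incl_excl]
  split_ifs <;> simp

noncomputable def mdM (n : ℕ) :
    MultilinearMap ℝ (fun _ : Fin n => Matrix (Fin n) (Fin n) ℝ) ℝ :=
  ∑ σ : Equiv.Perm (Fin n),
    MultilinearMap.domDomCongr σ
      (((Matrix.detRowAlternating (n := Fin n) (R := ℝ)).toMultilinearMap).compLinearMap
      (fun r => (LinearMap.proj r : (Fin n → Fin n → ℝ) →ₗ[ℝ] (Fin n → ℝ))))

theorem mdM_apply {n : ℕ} (M : Fin n → Matrix (Fin n) (Fin n) ℝ) :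
    mdM n M = (n.factorial : ℝ) * mixedDisc M := by
  rw [perm_formula, mdM, _root_.sum_apply]
  rfl

theorem rank_one {n : ℕ} (V : Matrix (Fin n) (Fin n) ℝ) :
    mdM n (fun j => Matrix.vecMulVec (V j) (V j)) = V.det ^ 2 := by
  rw [mdM_apply, perm_formula]
  have : ∀ σ : Equiv.Perm (Fin n),
      Matrix.det (fun r => Matrix.vecMulVec (V (σ r)) (V (σ r)) r) =
      ((Equiv.Perm.sign σ : ℤ) : ℝ) * (∏ r, V (σ r) r) * V.det := by
    intro σ
    have h := Matrix.det_mul_column (fun r => V (σ r) r) (V.submatrix σ id)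
    rw [Matrix.det_permute] at h
    have h2 : (fun r => Matrix.vecMulVec (V (σ r)) (V (σ r)) r) =
      Matrix.of fun i j => V (σ i) i * (V.submatrix σ id) i j := by
      ext i j
      simp [Matrix.vecMulVec_apply]
    rw [h2, h]
    ring
  rw [Finset.sum_congr rfl fun σ _ => this σ, ← Finset.sum_mul, sq]
  congr 1
  rw [Matrix.det_apply']

theorem expand {n : ℕ} (w : Fin n → Fin n → ℝ) (U : Fin n → Matrix (Fin n) (Fin n) ℝ) :
    (n.factorial : ℝ) * mixedDisc (fun j => (U j)ᵀ * Matrix.diagonal (w j) * U j) =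
      ∑ g : Fin n → Fin n, (∏ j, w j (g j)) * (Matrix.det (fun j => U j (g j))) ^ 2 := by
  rw [← mdM_apply]
  have : (fun j => (U j)ᵀ * Matrix.diagonal (w j) * U j) =
      fun j => ∑ r, w j r • Matrix.vecMulVec (U j r) (U j r) := by
    funext j
    ext a b
    rw [Matrix.mul_apply, Matrix.sum_apply]
    refine Finset.sum_congr rfl fun r _ => ?_
    simp [Matrix.mul_diagonal, Matrix.vecMulVec_apply]
    ring
  rw [this, MultilinearMap.map_sum]
  refine Finset.sum_congr rfl fun g _ => ?_
  rw [MultilinearMap.map_smul_univ, smul_eq_mul, rank_one (fun j => U j (g j))]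

theorem psd_rep {n : ℕ} {A : Matrix (Fin n) (Fin n) ℝ} (hA : A.PosSemidef) :
    ∃ C : Matrix (Fin n) (Fin n) ℝ, A = Cᵀ * C := by
  have hs := hA.1.spectral_theorem
  rw [Unitary.conjStarAlgAut_apply] at hs
  refine ⟨Matrix.diagonal (fun i => √(hA.1.eigenvalues i)) *
    star (hA.1.eigenvectorUnitary : Matrix (Fin n) (Fin n) ℝ), ?_⟩
  rw [Matrix.transpose_mul, Matrix.mul_assoc,
    ← Matrix.mul_assoc (Matrix.diagonal _)ᵀ, Matrix.diagonal_transpose,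
    Matrix.diagonal_mul_diagonal]
  conv_lhs => rw [hs]
  rw [Matrix.mul_assoc]
  have : (Matrix.diagonal (RCLike.ofReal ∘ hA.1.eigenvalues) : Matrix (Fin n) (Fin n) ℝ) =
    Matrix.diagonal (fun i => √(hA.1.eigenvalues i) * √(hA.1.eigenvalues i)) := by
    congr 1
    funext i
    simp [Real.mul_self_sqrt (hA.eigenvalues_nonneg i)]
  rw [this, Matrix.star_eq_conjTranspose, Matrix.conjTranspose_eq_transpose_of_trivial,
    Matrix.transpose_transpose]

theorem nonneg {n : ℕ} (M : Fin n → Matrix (Fin n) (Fin n) ℝ) (hM : ∀ j, (M j).PosSemidef) :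
    0 ≤ mixedDisc M := by
  choose C hC using fun j => psd_rep (hM j)
  have h := expand (fun _ _ => (1 : ℝ)) C
  have h2 : (fun j => (C j)ᵀ * Matrix.diagonal (fun _ => (1 : ℝ)) * C j) = M := by
    funext j
    rw [hC j]
    simp
  rw [h2] at h
  have : 0 ≤ (n.factorial : ℝ) * mixedDisc M := by
    rw [h]
    exact Finset.sum_nonneg fun g _ => by simp; positivity
  exact nonneg_of_mul_nonneg_right this (by positivity)

theorem simul {n : ℕ} {A B : Matrix (Fin n) (Fin n) ℝ} (hA : A.PosSemidef) (hB : B.PosSemidef)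
    (h0 : A.det ≠ 0) : ∃ (U : Matrix (Fin n) (Fin n) ℝ) (b : Fin n → ℝ), (∀ i, 0 ≤ b i) ∧
      A = Uᵀ * U ∧ B = Uᵀ * Matrix.diagonal b * U := by
  obtain ⟨C, hC⟩ := psd_rep hA
  have hCd : IsUnit C.det := by
    rw [isUnit_iff_ne_zero]
    rintro h
    apply h0
    rw [hC, Matrix.det_mul, h, mul_zero]
  have hB' := hB.conjTranspose_mul_mul_same C⁻¹
  rw [Matrix.conjTranspose_eq_transpose_of_trivial] at hB'
  have hs := hB'.1.spectral_theorem
  rw [Unitary.conjStarAlgAut_apply] at hs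
  set V : Matrix (Fin n) (Fin n) ℝ := (hB'.1.eigenvectorUnitary : Matrix (Fin n) (Fin n) ℝ) with hV
  have hVV : V * Vᵀ = 1 := by
    have := Unitary.coe_mul_star_self hB'.1.eigenvectorUnitary
    rwa [Unitary.coe_star, Matrix.star_eq_conjTranspose,
      Matrix.conjTranspose_eq_transpose_of_trivial] at this
  rw [Matrix.star_eq_conjTranspose, Matrix.conjTranspose_eq_transpose_of_trivial] at hs
  refine ⟨Vᵀ * C, hB'.1.eigenvalues, hB'.eigenvalues_nonneg, ?_, ?_⟩
  · rw [Matrix.transpose_mul, Matrix.transpose_transpose, Matrix.mul_assoc,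
      ← Matrix.mul_assoc V, hVV, Matrix.one_mul, hC]
  · have e1 : C⁻¹ * C = 1 := Matrix.nonsing_inv_mul C hCd
    have e2 : Cᵀ * (C⁻¹)ᵀ = 1 := by rw [← Matrix.transpose_mul, e1, Matrix.transpose_one]
    have : B = Cᵀ * ((C⁻¹)ᵀ * B * C⁻¹) * C := by
      calc B = (Cᵀ * (C⁻¹)ᵀ) * B * (C⁻¹ * C) := by rw [e1, e2]; simp
        _ = _ := by simp only [Matrix.mul_assoc]
    refine this.trans ?_
    rw [Matrix.transpose_mul, Matrix.transpose_transpose]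
    refine (congrArg (fun X => Cᵀ * X * C) hs).trans ?_
    simp only [Matrix.mul_assoc]
    rfl

/-- Expansion when all the vectors come from one matrix. -/
theorem expand_single {n : ℕ} (w : Fin n → Fin n → ℝ) (U : Matrix (Fin n) (Fin n) ℝ) :
    (n.factorial : ℝ) * mixedDisc (fun j => Uᵀ * Matrix.diagonal (w j) * U) =
      U.det ^ 2 * ∑ σ : Equiv.Perm (Fin n), ∏ j, w j (σ j) := by
  rw [expand w (fun _ => U), ← sum_bijective_eq (fun f => ∏ j, w j (f j)), Finset.mul_sum]
  refine Finset.sum_congr rfl fun g _ => ?_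
  split_ifs with hg
  · have h := Matrix.det_permute (Equiv.ofBijective g hg) U
    have h2 : (Matrix.det (fun j => U (g j))) =
      ((Equiv.Perm.sign (Equiv.ofBijective g hg) : ℤ) : ℝ) * U.det := h
    rw [h2, mul_pow]
    have h3 : (((Equiv.Perm.sign (Equiv.ofBijective g hg) : ℤ) : ℝ)) ^ 2 = 1 := by
      rcases Int.units_eq_one_or (Equiv.Perm.sign (Equiv.ofBijective g hg)) with h | h <;>
        simp [h]
    rw [h3]
    ring
  · rw [← Finite.injective_iff_bijective] at hg
    simp only [Function.Injective, not_forall] at hg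
    obtain ⟨i, j, hij, hne⟩ := hg
    rw [Matrix.det_zero_of_row_eq (M := fun j => U (g j)) hne (by simp [hij])]
    simp

theorem comb {n k : ℕ} (hkn : k ≤ n) (b : Fin n → ℝ) (hb : ∀ i, 0 ≤ b i) (g : Fin n → Fin n)
    (hg : Set.InjOn g {j | (j : ℕ) < k}) :
    ((k.factorial * (n - k).factorial : ℕ) : ℝ) * ∏ j : Fin n, (if (j : ℕ) < k then b (g j) else 1) ≤
      ∑ σ : Equiv.Perm (Fin n), ∏ j : Fin n, (if (j : ℕ) < k then b (σ j) else 1) := by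
  classical
  let p : Fin n → Prop := fun j => (j : ℕ) < k
  obtain ⟨τ, hτ⟩ : ∃ τ : Equiv.Perm (Fin n), ∀ j : Fin n, (j : ℕ) < k → τ j = g j := by
    obtain ⟨e, he⟩ := Finset.exists_equiv_extend_of_card_eq (α := Fin n) (β := Fin n)
      (t := Finset.univ) (by simp) (s := Finset.univ.filter p) (f := g) (by simp)
      (by simpa [p] using hg)
    refine ⟨e.trans ⟨fun x => x.1, fun x => ⟨x, by simp⟩, fun x => rfl, fun x => rfl⟩, ?_⟩
    intro j hj
    exact he j (by simpa [p] using hj)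
  let Φ : Equiv.Perm {a // p a} × Equiv.Perm {a // ¬ p a} → Equiv.Perm (Fin n) :=
    fun x => τ * Equiv.Perm.subtypeCongrHom p x
  have hΦ : Function.Injective Φ := fun x y h =>
    Equiv.Perm.subtypeCongrHom_injective p (mul_left_cancel h)
  have hval : ∀ x, ∏ j : Fin n, (if (j : ℕ) < k then b (Φ x j) else 1) =
      ∏ j : Fin n, (if (j : ℕ) < k then b (g j) else 1) := by
    intro x
    have key : ∀ j, ((Equiv.Perm.subtypeCongrHom p x j : Fin n) : ℕ) < k ↔ (j : ℕ) < k := by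
      intro j
      change ((Equiv.Perm.subtypeCongr x.1 x.2 j : Fin n) : ℕ) < k ↔ _
      by_cases h : p j
      · rw [Equiv.Perm.subtypeCongr.left_apply _ _ h]
        exact iff_of_true (x.1 ⟨j, h⟩).2 h
      · rw [Equiv.Perm.subtypeCongr.right_apply _ _ h]
        exact iff_of_false (x.2 ⟨j, h⟩).2 h
    rw [← Equiv.prod_comp (Equiv.Perm.subtypeCongrHom p x)
      (fun j => if (j : ℕ) < k then b (g j) else 1)]
    refine Finset.prod_congr rfl fun j _ => ?_
    by_cases h : (j : ℕ) < k
    · rw [if_pos h, if_pos ((key j).2 h), ← hτ _ ((key j).2 h)]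
      rfl
    · rw [if_neg h, if_neg (fun h' => h ((key j).1 h'))]
  have hcard : Fintype.card {a : Fin n // p a} = k := by
    rw [Fintype.card_subtype]
    have : (Finset.univ.filter p) = Finset.univ.filter (fun j : Fin n => (j : ℕ) < k) := rfl
    rw [this, Fin.card_filter_val_lt]
    omega
  have hcard2 : Fintype.card (Equiv.Perm {a // p a} × Equiv.Perm {a // ¬ p a}) =
      k.factorial * (n - k).factorial := by
    rw [Fintype.card_prod, Fintype.card_perm, Fintype.card_perm, Fintype.card_subtype_compl,
      hcard, Fintype.card_fin]
  calc _ = ∑ x, ∏ j : Fin n, (if (j : ℕ) < k then b (Φ x j) else 1) := by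
        rw [Finset.sum_congr rfl fun x _ => hval x, Finset.sum_const, Finset.card_univ, hcard2,
          nsmul_eq_mul]
    _ = ∑ σ ∈ Finset.univ.map ⟨Φ, hΦ⟩, ∏ j : Fin n, (if (j : ℕ) < k then b (σ j) else 1) := by
        rw [Finset.sum_map]; rfl
    _ ≤ _ := by
        apply Finset.sum_le_sum_of_subset_of_nonneg (Finset.subset_univ _)
        intro σ _ _
        refine Finset.prod_nonneg fun j _ => ?_
        split_ifs
        · exact hb _
        · exact zero_le_one

theorem rev_sum {n k : ℕ} (hkn : k ≤ n) (b : Fin n → ℝ) :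
    ∑ σ : Equiv.Perm (Fin n), ∏ j : Fin n, (if (j : ℕ) < n - k then 1 else b (σ j)) =
    ∑ σ : Equiv.Perm (Fin n), ∏ j : Fin n, (if (j : ℕ) < k then b (σ j) else 1) := by
  rw [← Equiv.sum_comp (Equiv.mulRight (Fin.revPerm : Equiv.Perm (Fin n)))
    (fun σ : Equiv.Perm (Fin n) => ∏ j : Fin n, (if (j : ℕ) < k then b (σ j) else 1))]
  refine Finset.sum_congr rfl fun σ _ => ?_
  rw [← Equiv.prod_comp (Fin.revPerm : Equiv.Perm (Fin n))]
  refine Finset.prod_congr rfl fun j _ => ?_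
  have hj := j.isLt
  by_cases h : (j : ℕ) < k
  · rw [if_pos h, if_neg (by simp; omega)]
    simp
  · rw [if_neg h, if_pos (by simp; omega)]

end XiaoAux

open XiaoAux Matrix in
theorem xiao_mixed_discriminant (n k : ℕ) (hn : 2 ≤ n) (hk1 : 1 ≤ k) (hkn : k ≤ n)
    (A B : Matrix (Fin n) (Fin n) ℝ) (M : Fin (n - k) → Matrix (Fin n) (Fin n) ℝ)
    (hA : A.PosSemidef) (hB : B.PosSemidef) (hM : ∀ l, (M l).PosSemidef) :
    A.det * mixedDisc (fun j : Fin n =>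
        if h : (j : ℕ) < k then B else M ⟨(j : ℕ) - k, by have := j.isLt; omega⟩) ≤
      (n.choose k : ℝ) *
        mixedDisc (fun j : Fin n => if (j : ℕ) < n - k then A else B) *
        mixedDisc (fun j : Fin n =>
          if h : (j : ℕ) < k then A else M ⟨(j : ℕ) - k, by have := j.isLt; omega⟩) := by
  by_cases h0 : A.det = 0
  · rw [h0, zero_mul]
    refine mul_nonneg (mul_nonneg (by positivity) (nonneg _ fun j => ?_)) (nonneg _ fun j => ?_)
    · split_ifs <;> assumption
    · split_ifs
      · exact hA
      · exact hM _
  obtain ⟨U, b, hb, hAU, hBU⟩ := simul hA hB h0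
  choose C hC using fun l => psd_rep (hM l)
  -- the common family of vectors
  let W : Fin n → Matrix (Fin n) (Fin n) ℝ := fun j =>
    if h : (j : ℕ) < k then U else C ⟨(j : ℕ) - k, by have := j.isLt; omega⟩
  have e1 := expand (fun j i => if (j : ℕ) < k then b i else 1) W
  have e2 := expand (fun _ _ => (1 : ℝ)) W
  have e3 := expand_single (fun (j : Fin n) i => if (j : ℕ) < n - k then 1 else b i) U
  have f1 : (fun j => (W j)ᵀ * Matrix.diagonal (fun i => if (j : ℕ) < k then b i else 1) * W j) =
      (fun j : Fin n =>
        if h : (j : ℕ) < k then B else M ⟨(j : ℕ) - k, by have := j.isLt; omega⟩) := by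
    funext j
    by_cases h : (j : ℕ) < k
    · simp only [W, h, dif_pos, if_true]
      exact hBU.symm
    · simp only [W, h, if_false, dif_neg, not_false_eq_true]
      rw [hC]
      simp
  have f2 : (fun j => (W j)ᵀ * Matrix.diagonal (fun _ => (1 : ℝ)) * W j) =
      (fun j : Fin n =>
        if h : (j : ℕ) < k then A else M ⟨(j : ℕ) - k, by have := j.isLt; omega⟩) := by
    funext j
    by_cases h : (j : ℕ) < k
    · simp only [W, h, dif_pos]
      rw [hAU]
      simp
    · simp only [W, h, dif_neg, not_false_eq_true]
      rw [hC]
      simp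
  have f3 : (fun j : Fin n => Uᵀ *
        Matrix.diagonal (fun i => if (j : ℕ) < n - k then 1 else b i) * U) =
      (fun j : Fin n => if (j : ℕ) < n - k then A else B) := by
    funext j
    by_cases h : (j : ℕ) < n - k
    · simp only [h, if_true]
      rw [hAU]
      simp
    · simp only [h, if_false]
      exact hBU.symm
  rw [f1] at e1
  rw [f2] at e2
  rw [f3, rev_sum hkn] at e3
  have hdet : U.det ^ 2 = A.det := by
    rw [hAU, Matrix.det_mul, Matrix.det_transpose, sq]
  rw [hdet] at e3
  have hApos : 0 ≤ A.det := hdet ▸ sq_nonneg _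
  simp only [Finset.prod_const_one, one_mul] at e2
  set S := ∑ σ : Equiv.Perm (Fin n), ∏ j : Fin n, (if (j : ℕ) < k then b (σ j) else 1) with hS
  have main : ((k.factorial * (n - k).factorial : ℕ) : ℝ) *
      ∑ g : Fin n → Fin n, (∏ j : Fin n, if (j : ℕ) < k then b (g j) else 1) *
        (Matrix.det (fun j => W j (g j))) ^ 2 ≤
      S * ∑ g : Fin n → Fin n, (Matrix.det (fun j => W j (g j))) ^ 2 := by
    rw [Finset.mul_sum, Finset.mul_sum]
    refine Finset.sum_le_sum fun g _ => ?_
    by_cases hg : Set.InjOn g {j | (j : ℕ) < k}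
    · rw [← mul_assoc]
      exact mul_le_mul_of_nonneg_right (comb hkn b hb g hg) (sq_nonneg _)
    · have : Matrix.det (fun j => W j (g j)) = 0 := by
        simp only [Set.InjOn, not_forall] at hg
        obtain ⟨i, hi, j, hj, hij, hne⟩ := hg
        refine Matrix.det_zero_of_row_eq (M := fun j => W j (g j)) hne ?_
        simp only [Set.mem_ofPred_eq] at hi hj
        simp only [W, hi, hj, dif_pos, hij]
      rw [this]
      simp
  rw [← e1, ← e2] at main
  have hch : ((n.choose k : ℕ) : ℝ) * ((k.factorial * (n - k).factorial : ℕ) : ℝ) =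
      (n.factorial : ℝ) := by
    rw [← Nat.choose_mul_factorial_mul_factorial hkn]
    push_cast
    ring
  have hfac : (0 : ℝ) < n.factorial := by positivity
  have hK : (0 : ℝ) < ((k.factorial * (n - k).factorial : ℕ) : ℝ) := by positivity
  refine le_of_mul_le_mul_left ?_ (mul_pos hK hfac)
  calc _ = A.det * (((k.factorial * (n - k).factorial : ℕ) : ℝ) * ((n.factorial : ℝ) * _)) := by
        rw [mul_left_comm A.det, mul_left_comm A.det, mul_assoc]
    _ ≤ A.det * (S * ((n.factorial : ℝ) * _)) := mul_le_mul_of_nonneg_left main hApos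
    _ = (A.det * S) * ((n.factorial : ℝ) * _) := (mul_assoc _ _ _).symm
    _ = _ := by
        rw [← e3]
        nth_rewrite 1 [← hch]
        ring
end

section
/- Let $m \geq 1$, $n \geq 2$ and $i_1,\dots,i_m \geq 0$ be integers with $|i| := i_1 + \cdots + i_m \leq n$. Then for any positive semi-definite symmetric $n\times n$ matrices $A, B_1,\dots,B_m, M_1,\dots,M_{n-|i|}$: $\frac{n!}{i_1!\cdots i_m!(n-|i|)!} \det(A)^m D(B_1[i_1],\dots,B_m[i_m],M_1,\dots,M_{n-|i|}) \leq \binom{n}{|i|} D(M_1,\dots,M_{n-|i|},A[|i|]) \prod_{k=1}^m \binom{n}{i_k} D(B_k[i_k], A[n-i_k])$. -/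
/-- The list `B 0` repeated `i 0` times, then `B 1` repeated `i 1` times, etc. -/
def blocks {α : Type*} {m : ℕ} (i : Fin m → ℕ) (B : Fin m → α) : List α :=
  (List.ofFn fun k => List.replicate (i k) (B k)).flatten


open Matrix Finset

noncomputable def gxPolar {N J : Type*} [Fintype N] [DecidableEq N] [Fintype J] [DecidableEq J]
    (M : J → Matrix N N ℝ) : ℝ :=
  ∑ σ : N ≃ J, det (of fun r => M (σ r) r)

lemma gx_inner {n : ℕ} (f : Fin n → Fin n) :
    ∑ S : Finset (Fin n), (if ∀ r, f r ∈ S then (-1 : ℝ) ^ (n + S.card) else 0)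
      = if Function.Bijective f then 1 else 0 := by
  classical
  have h1 : ∑ S : Finset (Fin n), (if ∀ r, f r ∈ S then (-1 : ℝ) ^ (n + S.card) else 0)
      = ∑ U : Finset (Fin n), (if U ∈ ((univ.image f)ᶜ).powerset then (-1 : ℝ) ^ U.card else 0) := by
    refine Fintype.sum_equiv (compl_involutive.toPerm (compl : Finset (Fin n) → Finset (Fin n))) _ _ ?_
    intro S
    have hc : (Sᶜ : Finset (Fin n)).card + S.card = n := by
      rw [card_compl_add_card]; simp
    have : (∀ r, f r ∈ S) ↔ Sᶜ ∈ ((univ.image f)ᶜ).powerset := by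
      rw [mem_powerset, compl_subset_compl]
      simp [subset_iff]
    change _ = if Sᶜ ∈ ((univ.image f)ᶜ).powerset then (-1 : ℝ) ^ (Sᶜ).card else 0
    by_cases h : ∀ r, f r ∈ S
    · rw [if_pos h, if_pos (this.1 h)]
      nth_rewrite 1 [← hc]
      rw [add_assoc, pow_add, ← two_mul, pow_mul]; simp
    · rw [if_neg h, if_neg (fun h' => h (this.2 h'))]
  rw [h1, ← sum_filter]
  have h2 : ((univ : Finset (Finset (Fin n))).filter (· ∈ ((univ.image f)ᶜ).powerset))
    = ((univ.image f)ᶜ).powerset := by ext; simp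
  rw [h2]
  have h3 := Finset.sum_powerset_neg_one_pow_card (x := (univ.image f)ᶜ)
  have h4 := congrArg (Int.cast : ℤ → ℝ) h3
  push_cast at h4
  rw [h4]
  have : (univ.image f)ᶜ = ∅ ↔ Function.Bijective f := by
    have h5 : univ.image f = univ ↔ Function.Surjective f := by
      simp [Finset.ext_iff, Function.Surjective]
    rw [compl_eq_empty_iff, h5]
    exact ⟨fun h => ⟨Finite.injective_iff_surjective.2 h, h⟩, fun h => h.2⟩
  simp only [this]

lemma gx_mixed {n : ℕ} (M : Fin n → Matrix (Fin n) (Fin n) ℝ) :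
    mixedDisc M = (n.factorial : ℝ)⁻¹ * gxPolar M := by
  classical
  unfold mixedDisc gxPolar
  congr 1
  have h1 : ∀ S : Finset (Fin n), (∑ i ∈ S, M i).det =
      ∑ f : Fin n → Fin n, if ∀ r, f r ∈ S then det (of fun r => M (f r) r) else 0 := by
    intro S
    have := (detRowAlternating (n := Fin n) (R := ℝ)).toMultilinearMap.map_sum_finset
      (fun r j => M j r) (fun _ => S)
    have e : (∑ i ∈ S, M i) = fun r => ∑ j ∈ S, M j r := by
      ext r c; simp [Matrix.sum_apply]
    rw [e]
    refine this.trans ?_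
    rw [← sum_filter]
    refine sum_congr ?_ fun f _ => rfl
    ext f; simp
  simp_rw [h1, mul_sum]
  rw [sum_comm]
  have h2 : ∀ f : Fin n → Fin n, (∑ S : Finset (Fin n), (-1 : ℝ) ^ (n + S.card) *
      if ∀ r, f r ∈ S then det (of fun r => M (f r) r) else 0) =
      if Function.Bijective f then det (of fun r => M (f r) r) else 0 := by
    intro f
    have := congrArg (· * det (of fun r => M (f r) r)) (gx_inner f)
    simp only [sum_mul, ite_mul, one_mul, zero_mul] at this
    rw [← this]
    refine sum_congr rfl fun S _ => ?_
    split_ifs <;> simp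
  simp_rw [h2]
  rw [← sum_filter]
  symm
  refine sum_bij (fun σ _ => (σ : Fin n → Fin n)) ?_ ?_ ?_ ?_
  · intro σ _; exact mem_filter.2 ⟨mem_univ _, σ.bijective⟩
  · intro a _ b _ h; exact Equiv.coe_fn_injective h
  · intro f hf
    exact ⟨Equiv.ofBijective f (mem_filter.1 hf).2, mem_univ _, rfl⟩
  · intros; rfl

section
variable {N J K α : Type*} [Fintype N] [DecidableEq N] [Fintype J] [DecidableEq J]
  [Fintype K] [DecidableEq K] [Fintype α] [DecidableEq α]

lemma gxPolar_comp (e : K ≃ J) (M : J → Matrix N N ℝ) :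
    gxPolar (fun k => M (e k)) = gxPolar M := by
  unfold gxPolar
  exact Fintype.sum_equiv (Equiv.equivCongr (Equiv.refl N) e) _ _ (fun σ => rfl)

lemma gx_rank_one (e : N ≃ J) (V : J → N → ℝ) :
    ∑ σ : N ≃ J, (∏ r, V (σ r) r) * det (of fun r => V (σ r)) = det (of fun r => V (e r)) ^ 2 := by
  have h : ∑ σ : N ≃ J, (∏ r, V (σ r) r) * det (of fun r => V (σ r)) =
     ∑ π : Equiv.Perm N, (∏ r, V (e (π r)) r) * det (of fun r => V (e (π r))) := by
    symm
    exact Fintype.sum_equiv (Equiv.equivCongr (Equiv.refl N) e) _ _ (fun σ => rfl)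
  rw [h]
  have h2 : ∀ π : Equiv.Perm N, det (of fun r => V (e (π r))) =
      (Equiv.Perm.sign π : ℤ) * det (of fun r => V (e r)) := by
    intro π
    exact det_permute π (of fun r => V (e r))
  simp_rw [h2]
  rw [sq]
  nth_rewrite 2 [det_apply']
  rw [sum_mul]
  refine sum_congr rfl fun π _ => ?_
  simp only [of_apply]
  ring

lemma gx_expand (e : N ≃ J) (c : J → α → ℝ) (v : J → α → N → ℝ) :
    gxPolar (fun j => ∑ a, c j a • vecMulVec (v j a) (v j a)) =
      ∑ g : J → α, (∏ j, c j (g j)) * det (of fun r => v (e r) (g (e r))) ^ 2 := by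
  have h : ∀ σ : N ≃ J, det (of fun r => (∑ a, c (σ r) a • vecMulVec (v (σ r) a) (v (σ r) a)) r) =
      ∑ g : J → α, (∏ j, c j (g j)) * ((∏ r, v (σ r) (g (σ r)) r) *
        det (of fun r => v (σ r) (g (σ r)))) := by
    intro σ
    have h0 := (detRowAlternating (n := N) (R := ℝ)).toMultilinearMap.map_sum
      (fun r a => (c (σ r) a * v (σ r) a r) • v (σ r) a)
    have e : (of fun r => (∑ a, c (σ r) a • vecMulVec (v (σ r) a) (v (σ r) a)) r) =
       fun r => ∑ a, (c (σ r) a * v (σ r) a r) • v (σ r) a := by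
      ext r s; simp [Matrix.sum_apply, vecMulVec_apply, mul_assoc]
    rw [e]
    refine h0.trans ?_
    symm
    refine Fintype.sum_equiv (Equiv.arrowCongr σ.symm (Equiv.refl α)) _ _ fun g => ?_
    have h1 := (detRowAlternating (n := N) (R := ℝ)).toMultilinearMap.map_smul_univ
      (fun r => (c (σ r) (g (σ r)) * v (σ r) (g (σ r)) r)) (fun r => v (σ r) (g (σ r)))
    refine Eq.trans ?_ h1.symm
    rw [prod_mul_distrib, ← Equiv.prod_comp σ (fun j => c j (g j)), smul_eq_mul, mul_assoc]
    rfl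
  unfold gxPolar
  simp_rw [h]
  rw [sum_comm]
  refine sum_congr rfl fun g _ => ?_
  rw [← mul_sum, gx_rank_one e (fun j => v j (g j))]

lemma gx_spectral {M : Matrix N N ℝ} (h : M.PosSemidef) :
    ∃ (c : N → ℝ) (U : Matrix N N ℝ), (∀ a, 0 ≤ c a) ∧ U * Uᵀ = 1 ∧
      M = ∑ a, c a • vecMulVec (U a) (U a) := by
  refine ⟨h.1.eigenvalues, (h.1.eigenvectorUnitary : Matrix N N ℝ)ᵀ, h.eigenvalues_nonneg, ?_, ?_⟩
  · have := Unitary.coe_star_mul_self h.1.eigenvectorUnitary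
    simpa [star_eq_conjTranspose] using this
  · have := h.1.spectral_theorem
    rw [Unitary.conjStarAlgAut_apply] at this
    nth_rewrite 1 [this]
    ext r s
    simp [Matrix.mul_apply, Matrix.sum_apply, vecMulVec_apply, diagonal_apply]
    refine sum_congr rfl fun a _ => by ring

lemma gx_alt {p : Type*} [Fintype p] [DecidableEq p] (f : (N → ℝ) [⋀^p]→ₗ[ℝ] ℝ) (v : p → N → ℝ) :
    ((Fintype.card p).factorial : ℝ) * f v =
      ∑ g : p → N, det (of fun a b => v a (g b)) * f (fun a => Pi.single (g a) 1) := by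
  have h1 : ∀ u : p → N → ℝ, f u = ∑ g : p → N, (∏ a, u a (g a)) * f (fun a => Pi.single (g a) 1) := by
    intro u
    have h0 := f.toMultilinearMap.map_sum (fun a x => u a x • (Pi.single x 1 : N → ℝ))
    have e : u = fun a => ∑ x, u a x • (Pi.single x 1 : N → ℝ) := by
      ext a x; simp [Finset.sum_apply, Pi.single_apply]
    nth_rewrite 1 [e]
    refine h0.trans (sum_congr rfl fun g _ => ?_)
    exact f.toMultilinearMap.map_smul_univ (fun a => u a (g a)) (fun a => Pi.single (g a) 1)
  have h2 : ((Fintype.card p).factorial : ℝ) * f v =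
      ∑ σ : Equiv.Perm p, ((Equiv.Perm.sign σ : ℤ) : ℝ) * f (v ∘ σ) := by
    have : ∀ σ : Equiv.Perm p, ((Equiv.Perm.sign σ : ℤ) : ℝ) * f (v ∘ σ) = f v := by
      intro σ
      rw [f.map_perm]
      rcases Int.units_eq_one_or (Equiv.Perm.sign σ) with h | h <;> simp [h]
    simp [this, Fintype.card_perm]
  rw [h2]
  simp_rw [h1 (v ∘ _), mul_sum]
  rw [sum_comm]
  refine sum_congr rfl fun g _ => ?_
  rw [det_apply', sum_mul]
  refine sum_congr rfl fun σ _ => ?_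
  simp [mul_assoc]

lemma gx_cauchy_binet {p : Type*} [Fintype p] [DecidableEq p] (v : Matrix p N ℝ) :
    ∑ g : p → N, det (of fun a b => v a (g b)) ^ 2 =
      ((Fintype.card p).factorial : ℝ) * det (v * vᵀ) := by
  have := gx_alt ((detRowAlternating (n := p) (R := ℝ)).compLinearMap (Matrix.mulVecLin v)) v
  have e : ((detRowAlternating (n := p) (R := ℝ)).compLinearMap (Matrix.mulVecLin v)) v
     = det (v * vᵀ) := by
    refine congrArg det (?_ : (of fun a => v *ᵥ (v a)) = v * vᵀ)
    ext a b
    simp [Matrix.mul_apply, mulVec, dotProduct, mul_comm]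
  rw [e] at this
  rw [this]
  refine sum_congr rfl fun g _ => ?_
  rw [sq]
  congr 1
  rw [← det_transpose]
  refine congrArg det (?_ : _ = (of fun a => v *ᵥ (Pi.single (g a) 1)))
  ext a b
  simp

lemma gx_cs {p : Type*} [Fintype p] [DecidableEq p] (f : (N → ℝ) [⋀^p]→ₗ[ℝ] ℝ) (v : Matrix p N ℝ) :
    ((Fintype.card p).factorial : ℝ) * f v ^ 2 ≤
      det (v * vᵀ) * ∑ g : p → N, f (fun a => Pi.single (g a) 1) ^ 2 := by
  have h := sum_mul_sq_le_sq_mul_sq univ (fun g : p → N => det (of fun a b => v a (g b)))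
    (fun g : p → N =>  f (fun a => Pi.single (g a) 1))
  have h3 := gx_alt f v
  rw [gx_cauchy_binet] at h
  have h4 := (congrArg (fun x : ℝ => x ^ 2) h3).trans_le h
  change (((Fintype.card p).factorial : ℝ) * f v) ^ 2 ≤ _ at h4
  have hp : (0 : ℝ) < ((Fintype.card p).factorial : ℝ) := by positivity
  refine le_of_mul_le_mul_left ?_ hp
  linarith [mul_pow ((Fintype.card p).factorial : ℝ) (f v) 2]

lemma gx_hadamard {p : Type*} [Fintype p] [DecidableEq p] (G : Matrix p p ℝ) (hG : G.PosSemidef)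
    (h1 : ∀ a, G a a = 1) : G.det ≤ 1 := by
  have ht := hG.1.trace_eq_sum_eigenvalues
  have ht2 : G.trace = Fintype.card p := by simp [Matrix.trace, h1]
  rw [hG.1.det_eq_prod_eigenvalues]
  calc ∏ a, (hG.1.eigenvalues a : ℝ) ≤ ∏ a, Real.exp (hG.1.eigenvalues a - 1) := by
        refine prod_le_prod (fun a _ => hG.eigenvalues_nonneg a) fun a _ => ?_
        have := Real.add_one_le_exp (hG.1.eigenvalues a - 1)
        linarith
    _ = 1 := by
        rw [← Real.exp_sum, sum_sub_distrib]
        rw [ht2] at ht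
        simp only [RCLike.ofReal_real_eq_id, id] at ht
        rw [← ht]; simp
lemma gx_equiv {β : Type*} (f : J → β) (g : K → β)
    (h : univ.val.map f = univ.val.map g) : ∃ e : J ≃ K, ∀ x, f x = g (e x) := by
  classical
  have hc : ∀ y, Nonempty ({x // f x = y} ≃ {x // g x = y}) := by
    intro y
    refine Fintype.card_eq.1 ?_
    have := congrArg (Multiset.count y) h
    rw [Multiset.count_map, Multiset.count_map] at this
    rw [Fintype.card_subtype, Fintype.card_subtype]
    simp only [eq_comm (a := y)] at this
    exact this
  let E := fun y => (hc y).some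
  refine ⟨(Equiv.sigmaFiberEquiv f).symm.trans ((Equiv.sigmaCongrRight E).trans
    (Equiv.sigmaFiberEquiv g)), fun x => ?_⟩
  have := (E (f x) ⟨x, rfl⟩).2
  exact this.symm

lemma gx_mixed_congr {n : ℕ} (F : Fin n → Matrix (Fin n) (Fin n) ℝ) (G : J → Matrix (Fin n) (Fin n) ℝ)
    (h : univ.val.map F = univ.val.map G) :
    mixedDisc F = (n.factorial : ℝ)⁻¹ * gxPolar G := by
  obtain ⟨e, he⟩ := gx_equiv F G h
  rw [gx_mixed, ← gxPolar_comp e]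
  congr 2
  funext x; exact he x

lemma gx_nonneg (M : J → Matrix N N ℝ) (h : ∀ j, (M j).PosSemidef) : 0 ≤ gxPolar M := by
  by_cases hne : Nonempty (N ≃ J)
  · obtain ⟨e⟩ := hne
    choose c U hc _ hM using fun j => gx_spectral (h j)
    rw [show M = _ from funext hM, gx_expand e c (fun j a => U j a)]
    exact sum_nonneg fun g _ => mul_nonneg (prod_nonneg fun j _ => hc _ _) (sq_nonneg _)
  · unfold gxPolar
    have := not_nonempty_iff.1 hne
    simp

lemma gx_one : (1 : Matrix N N ℝ) =
    ∑ a, (1 : ℝ) • vecMulVec (Pi.single a 1) (Pi.single a 1) := by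
  ext r s
  simp [Matrix.sum_apply, vecMulVec_apply, Matrix.one_apply, Pi.single_apply]

lemma gx_one' {U : Matrix N N ℝ} (hU : U * Uᵀ = 1) : (1 : Matrix N N ℝ) =
    ∑ a, (1 : ℝ) • vecMulVec (U a) (U a) := by
  rw [← mul_eq_one_comm.1 hU]
  ext r s
  simp [Matrix.sum_apply, vecMulVec_apply, Matrix.mul_apply]

/-- lower bound for one block -/
lemma gx_lower {P Q : Type*} [Fintype P] [DecidableEq P] [Fintype Q] [DecidableEq Q]
    (e : N ≃ P ⊕ Q) (c : N → ℝ) (hc : ∀ a, 0 ≤ c a) (U : Matrix N N ℝ) (hU : U * Uᵀ = 1) :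
    ((Fintype.card Q).factorial : ℝ) * ∑ g : P ↪ N, ∏ a, c (g a) ≤
     gxPolar (Sum.elim (fun _ : P => ∑ a, c a • vecMulVec (U a) (U a))
      (fun _ : Q => (1 : Matrix N N ℝ))) := by
  have h : (Sum.elim (fun _ : P => ∑ a, c a • vecMulVec (U a) (U a))
      (fun _ : Q => (1 : Matrix N N ℝ))) = fun j => ∑ a, 
      (Sum.elim (fun _ => c) (fun _ _ => 1) j : N → ℝ) a • vecMulVec (U a) (U a) := by
    funext j
    rcases j with j | j
    · rfl
    · exact gx_one' hU
  rw [h, gx_expand e _ (fun _ a => U a)]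
  have hext : ∀ g : P ↪ N, ∃ τ : P ⊕ Q ≃ N, ∀ a, τ (Sum.inl a) = g a := by
    intro g
    have hcard : Fintype.card Q = Fintype.card {x // x ∉ Set.range g} := by
      have h1 := Fintype.card_congr e
      rw [Fintype.card_sum] at h1
      have h2 : Fintype.card {x // x ∈ Set.range g} = Fintype.card P :=
        Fintype.card_congr (Equiv.ofInjective g g.injective).symm
      have h3 := Fintype.card_subtype_compl (fun x => x ∈ Set.range g)
      omega
    refine ⟨(Equiv.sumCongr (Equiv.ofInjective g g.injective) (Fintype.equivOfCardEq hcard)).trans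
      (Equiv.sumCompl (fun x => x ∈ Set.range g)), fun a => ?_⟩
    simp
  choose τ hτ using hext
  have hdet : ∀ ρ : P ⊕ Q ≃ N, det (of fun r => U (ρ (e r))) ^ 2 = 1 := by
    intro ρ
    have h1 : det (of fun r => U (ρ (e r))) = _ := det_permute (e.trans ρ) U
    have h2 := congrArg det hU
    rw [det_mul, det_transpose, det_one] at h2
    rw [h1, mul_pow, sq U.det, h2]
    rcases Int.units_eq_one_or (Equiv.Perm.sign (e.trans ρ)) with h | h <;> simp [h]
  let F : (P ↪ N) × Equiv.Perm Q → (P ⊕ Q → N) := fun x =>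
    (Equiv.sumCongr (Equiv.refl P) x.2).trans (τ x.1)
  have hF : Function.Injective F := by
    rintro ⟨g, π⟩ ⟨g', π'⟩ h
    have hg : g = g' := by
      ext a
      have := congrFun h (Sum.inl a)
      simpa [F, hτ] using this
    subst hg
    refine Prod.ext rfl (Equiv.ext fun b => ?_)
    have := congrFun h (Sum.inr b)
    simpa [F] using this
  calc ((Fintype.card Q).factorial : ℝ) * ∑ g : P ↪ N, ∏ a, c (g a)
      = ∑ x : (P ↪ N) × Equiv.Perm Q, ∏ a, c (x.1 a) := by
        rw [Fintype.sum_prod_type]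
        simp [Fintype.card_perm, mul_sum]
    _ = ∑ x : (P ↪ N) × Equiv.Perm Q, 
        (∏ j, (Sum.elim (fun _ => c) (fun _ _ => 1) j : N → ℝ) (F x j)) *
        det (of fun r => U (F x (e r))) ^ 2 := by
        refine sum_congr rfl fun x _ => ?_
        rw [hdet ((Equiv.sumCongr (Equiv.refl P) x.2).trans (τ x.1)), Fintype.prod_sum_type]
        simp [F, hτ]
    _ = ∑ y ∈ univ.image F, (∏ j, (Sum.elim (fun _ => c) (fun _ _ => 1) j : N → ℝ) (y j)) *
        det (of fun r => U (y (e r))) ^ 2 := by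
        rw [sum_image (fun _ _ _ _ h => hF h)]
    _ ≤ _ := by
        refine sum_le_sum_of_subset_of_nonneg (subset_univ _) fun g _ _ => ?_
        refine mul_nonneg (prod_nonneg fun j _ => ?_) (sq_nonneg _)
        rcases j with j | j
        · exact hc _
        · simp

/-- the determinant as an alternating map in the rows indexed by `P` -/
noncomputable def gxAlt {P Q : Type*} [Fintype P] [DecidableEq P] [Fintype Q] [DecidableEq Q]
    (e : N ≃ P ⊕ Q) (w : Q → N → ℝ) : (N → ℝ) [⋀^P]→ₗ[ℝ] ℝ where
  toFun u := (detRowAlternating (n := N) (R := ℝ)).domDomCongr e (Sum.elim u w)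
  map_update_add' u a x y := by
    simp only [← Sum.update_elim_inl, AlternatingMap.map_update_add]
  map_update_smul' u a x y := by
    simp only [← Sum.update_elim_inl, AlternatingMap.map_update_smul]
  map_eq_zero_of_eq' u a b h hab :=
    AlternatingMap.map_eq_zero_of_eq _ (Sum.elim u w) (i := Sum.inl a) (j := Sum.inl b) h
      (fun h => hab (Sum.inl_injective h))

lemma gxAlt_apply {P Q : Type*} [Fintype P] [DecidableEq P] [Fintype Q] [DecidableEq Q]
    (e : N ≃ P ⊕ Q) (w : Q → N → ℝ) (u : P → N → ℝ) :
    gxAlt e w u = det (of fun r => Sum.elim u w (e r)) := rfl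

lemma gx_expand2 {P Q : Type*} [Fintype P] [DecidableEq P] [Fintype Q] [DecidableEq Q]
    (e : N ≃ P ⊕ Q) (c : P → N → ℝ) (v : P → N → N → ℝ) (d : Q → N → ℝ) (w : Q → N → N → ℝ) :
    gxPolar (Sum.elim (fun x => ∑ a, c x a • vecMulVec (v x a) (v x a))
      (fun x => ∑ a, d x a • vecMulVec (w x a) (w x a))) =
    ∑ h : Q → N, (∏ l, d l (h l)) * ∑ g : P → N, (∏ x, c x (g x)) *
      gxAlt e (fun l => w l (h l)) (fun x => v x (g x)) ^ 2 := by
  have h0 : (Sum.elim (fun x => ∑ a, c x a • vecMulVec (v x a) (v x a))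
      (fun x => ∑ a, d x a • vecMulVec (w x a) (w x a))) = fun j => ∑ a,
       Sum.elim c d j a • vecMulVec (Sum.elim v w j a) (Sum.elim v w j a) := by
    funext j
    rcases j with j | j <;> rfl
  rw [h0, gx_expand e]
  simp_rw [mul_sum]
  rw [sum_comm, ← Fintype.sum_prod_type']
  refine Fintype.sum_equiv (Equiv.sumArrowEquivProdArrow P Q N) _ _ fun g => ?_
  rw [Fintype.prod_sum_type, gxAlt_apply]
  have : (of fun r => Sum.elim v w (e r) (g (e r))) = (of fun r => Sum.elim
    (fun x => v x ((Equiv.sumArrowEquivProdArrow P Q N g).1 x))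
    (fun l => w l ((Equiv.sumArrowEquivProdArrow P Q N g).2 l)) (e r)) := by
    funext r
    change Sum.elim v w (e r) (g (e r)) = Sum.elim
      (fun x => v x (g (Sum.inl x))) (fun l => w l (g (Sum.inr l))) (e r)
    rcases e r with j | j <;> rfl
  rw [this, ← mul_assoc, mul_comm (∏ l, d l _)]
  rfl

open Classical in
lemma gx_gram {ι : Type*} [Fintype ι] [DecidableEq ι] (i : ι → ℕ) (U : ι → Matrix N N ℝ)
    (hU : ∀ k, U k * (U k)ᵀ = 1) (g : (Σ k, Fin (i k)) → N) :
    det ((of fun x : (Σ k, Fin (i k)) => U x.1 (g x)) *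
      (of fun x : (Σ k, Fin (i k)) => U x.1 (g x))ᵀ) ≤
      ∏ k, if Function.Injective (fun a => g ⟨k, a⟩) then 1 else 0 := by
  set V : Matrix (Σ k, Fin (i k)) N ℝ := (of fun x : (Σ k, Fin (i k)) => U x.1 (g x)) with hV
  by_cases h : ∀ k, Function.Injective (fun a => g ⟨k, a⟩)
  · simp only [h, if_true, prod_const_one]
    refine gx_hadamard _ ?_ ?_
    · have := posSemidef_self_mul_conjTranspose V
      simpa using this
    · intro x
      have := congrFun (congrFun (hU x.1) (g x)) (g x)
      rw [one_apply_eq] at this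
      rw [← this]
      rfl
  · push Not at h
    obtain ⟨k, hk⟩ := h
    rw [prod_eq_zero (mem_univ k) (if_neg hk)]
    unfold Function.Injective at hk
    push Not at hk
    obtain ⟨a, b, hab, hne⟩ := hk
    refine le_of_eq (det_zero_of_row_eq (i := ⟨k, a⟩) (j := ⟨k, b⟩) (by simpa using hne) ?_)
    funext y
    have : V ⟨k, a⟩ = V ⟨k, b⟩ := by
      change U k (g ⟨k, a⟩) = U k (g ⟨k, b⟩)
      exact congrArg (U k) hab
    rw [mul_apply_eq_vecMul, mul_apply_eq_vecMul, this]

open Classical in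
lemma gx_unit {ι Q : Type*} [Fintype ι] [DecidableEq ι] [Fintype Q] [DecidableEq Q] (i : ι → ℕ)
    (e : N ≃ (Σ k, Fin (i k)) ⊕ Q)
    (c : ι → N → ℝ) (hc : ∀ k a, 0 ≤ c k a) (U : ι → Matrix N N ℝ)
    (hU : ∀ k, U k * (U k)ᵀ = 1) (M : Q → Matrix N N ℝ) (hM : ∀ l, (M l).PosSemidef) :
    ((∑ k, i k).factorial : ℝ) * gxPolar (Sum.elim (fun x : (Σ k, Fin (i k)) =>
      ∑ a, c x.1 a • vecMulVec (U x.1 a) (U x.1 a)) M) ≤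
    (∏ k, ∑ g : Fin (i k) ↪ N, ∏ a, c k (g a)) *
      gxPolar (Sum.elim (fun _ : (Σ k, Fin (i k)) => (1 : Matrix N N ℝ)) M) := by
  choose d W hd _ hMe using fun l => gx_spectral (hM l)
  rw [show M = _ from funext hMe]
  rw [show (fun _ : (Σ k, Fin (i k)) => (1 : Matrix N N ℝ)) = fun _ => _ from
    funext fun _ => gx_one]
  rw [gx_expand2 e (fun x a => c x.1 a) (fun x a => U x.1 a) d (fun l a => W l a),
    gx_expand2 e (fun _ _ => 1) (fun _ a => Pi.single a 1) d (fun l a => W l a)]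
  rw [mul_sum, mul_sum]
  refine sum_le_sum fun h _ => ?_
  rw [mul_left_comm, mul_left_comm (∏ k, ∑ g : Fin (i k) ↪ N, ∏ a, c k (g a))]
  refine mul_le_mul_of_nonneg_left ?_ (prod_nonneg fun l _ => hd _ _)
  simp only [prod_const_one, one_mul]
  set f := gxAlt e (fun l => W l (h l)) with hf
  set S := ∑ t : (Σ k, Fin (i k)) → N, f (fun x => Pi.single (t x) 1) ^ 2 with hS
  have hS0 : 0 ≤ S := sum_nonneg fun _ _ => sq_nonneg _
  have hE : (∏ k, ∑ g : Fin (i k) ↪ N, ∏ a, c k (g a)) =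
      ∑ g : (Σ k, Fin (i k)) → N, (∏ x, c x.1 (g x)) *
        ∏ k, if Function.Injective (fun a => g ⟨k, a⟩) then 1 else 0 := by
    have h1 : ∀ k, ∑ g : Fin (i k) ↪ N, ∏ a, c k (g a) = ∑ g : Fin (i k) → N,
        (∏ a, c k (g a)) * if Function.Injective g then 1 else 0 := by
      intro k
      simp only [mul_ite, mul_one, mul_zero]
      rw [← sum_filter]
      refine sum_bij (fun g _ => (g : Fin (i k) → N)) ?_ ?_ ?_ ?_
      · intro g _; exact mem_filter.2 ⟨mem_univ _, g.injective⟩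
      · intro a _ b _ h; exact DFunLike.coe_injective h
      · intro g hg; exact ⟨⟨g, (mem_filter.1 hg).2⟩, mem_univ _, rfl⟩
      · intros; rfl
    simp_rw [h1]
    rw [Fintype.prod_sum]
    symm
    refine Fintype.sum_equiv (Equiv.piCurry (fun (k : ι) (_ : Fin (i k)) => N)) _ _ fun g => ?_
    rw [prod_mul_distrib, Fintype.prod_sigma]
    rfl
  rw [hE, sum_mul, mul_sum]
  refine sum_le_sum fun g _ => ?_
  rw [mul_left_comm, mul_assoc]
  refine mul_le_mul_of_nonneg_left ?_ (prod_nonneg fun l _ => hc _ _)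
  have h1 := gx_cs f (of fun x : (Σ k, Fin (i k)) => U x.1 (g x))
  have h2 : Fintype.card (Σ k, Fin (i k)) = ∑ k, i k := by simp
  rw [h2] at h1
  refine h1.trans (mul_le_mul_of_nonneg_right (gx_gram i U hU g) hS0)

end

lemma gx_main_unit (m n : ℕ)
    (i : Fin m → ℕ) (hi : ∑ k, i k ≤ n)
    (B : Fin m → Matrix (Fin n) (Fin n) ℝ)
    (M : Fin (n - ∑ k, i k) → Matrix (Fin n) (Fin n) ℝ)
    (hB : ∀ k, (B k).PosSemidef) (hM : ∀ l, (M l).PosSemidef) :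
    ((∑ k, i k).factorial : ℝ) * gxPolar (Sum.elim (fun x : (Σ k, Fin (i k)) => B x.1) M) *
      ∏ k, ((n - i k).factorial : ℝ) ≤
    (∏ k, gxPolar (Sum.elim (fun _ : Fin (i k) => B k) (fun _ : Fin (n - i k) => 1))) *
      gxPolar (Sum.elim (fun _ : (Σ k, Fin (i k)) => (1 : Matrix (Fin n) (Fin n) ℝ)) M) := by
  choose c U hc hU hBe using fun k => gx_spectral (hB k)
  have hik : ∀ k, i k ≤ n := fun k =>
    (single_le_sum (f := i) (fun _ _ => Nat.zero_le _) (mem_univ k)).trans hi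
  have e : Fin n ≃ (Σ k, Fin (i k)) ⊕ Fin (n - ∑ k, i k) :=
    Fintype.equivOfCardEq (by simp; omega)
  have h1 := gx_unit i e c hc U hU M hM
  rw [show (fun x : (Σ k, Fin (i k)) => B x.1) = _ from funext fun x => hBe x.1]
  have hprod : (0 : ℝ) ≤ ∏ k, ((n - i k).factorial : ℝ) := by positivity
  refine (mul_le_mul_of_nonneg_right h1 hprod).trans ?_
  rw [mul_right_comm, ← prod_mul_distrib]
  refine mul_le_mul_of_nonneg_right ?_ (gx_nonneg _ ?_)
  · refine prod_le_prod (fun k _ => ?_) fun k _ => ?_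
    · exact mul_nonneg (sum_nonneg fun g _ => prod_nonneg fun a _ => hc _ _) (by positivity)
    · have e2 : Fin n ≃ Fin (i k) ⊕ Fin (n - i k) :=
        Fintype.equivOfCardEq (by have := hik k; simp; omega)
      have := gx_lower e2 (c k) (hc k) (U k) (hU k)
      rw [← hBe k, Fintype.card_fin] at this
      rw [mul_comm]; exact this
  · rintro (x | x)
    · exact PosSemidef.one
    · exact hM x

lemma gx_conj {n : ℕ} (M : Fin n → Matrix (Fin n) (Fin n) ℝ) (C : Matrix (Fin n) (Fin n) ℝ) :
    mixedDisc (fun j => Cᵀ * M j * C) = C.det ^ 2 * mixedDisc M := by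
  unfold mixedDisc
  rw [mul_left_comm (C.det ^ 2), Finset.mul_sum univ _ (C.det ^ 2)]
  refine congrArg _ (Finset.sum_congr rfl fun S _ => ?_)
  have hs : ∑ j ∈ S, Cᵀ * M j * C = Cᵀ * (∑ j ∈ S, M j) * C := by
    rw [Matrix.mul_sum, Matrix.sum_mul]
  rw [hs, det_mul, det_mul, det_transpose]
  ring

lemma gx_polar_conj {J : Type*} [Fintype J] [DecidableEq J] {n : ℕ} (e : Fin n ≃ J)
    (M : J → Matrix (Fin n) (Fin n) ℝ) (C : Matrix (Fin n) (Fin n) ℝ) :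
    gxPolar (fun j => Cᵀ * M j * C) = C.det ^ 2 * gxPolar M := by
  have h := gx_conj (fun j => M (e j)) C
  rw [gx_mixed, gx_mixed, gxPolar_comp e M, gxPolar_comp e (fun j => Cᵀ * M j * C),
    mul_left_comm] at h
  exact mul_left_cancel₀ (by positivity) h

lemma gx_main (m n : ℕ) (hm : 1 ≤ m)
    (i : Fin m → ℕ) (hi : ∑ k, i k ≤ n) (A : Matrix (Fin n) (Fin n) ℝ)
    (B : Fin m → Matrix (Fin n) (Fin n) ℝ)
    (M : Fin (n - ∑ k, i k) → Matrix (Fin n) (Fin n) ℝ) (hA : A.PosSemidef)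
    (hB : ∀ k, (B k).PosSemidef) (hM : ∀ l, (M l).PosSemidef) :
    ((∑ k, i k).factorial : ℝ) * (A.det ^ m *
      gxPolar (Sum.elim (fun x : (Σ k, Fin (i k)) => B x.1) M)) *
      ∏ k, ((n - i k).factorial : ℝ) ≤
    (∏ k, gxPolar (Sum.elim (fun _ : Fin (i k) => B k) (fun _ : Fin (n - i k) => A))) *
      gxPolar (Sum.elim (fun _ : (Σ k, Fin (i k)) => A) M) := by
  have hik : ∀ k, i k ≤ n := fun k =>
    (single_le_sum (f := i) (fun _ _ => Nat.zero_le _) (mem_univ k)).trans hi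
  by_cases hdet : A.det = 0
  · rw [hdet, zero_pow (by omega)]
    simp only [zero_mul, mul_zero]
    refine mul_nonneg (prod_nonneg fun k _ => gx_nonneg _ ?_) (gx_nonneg _ ?_)
    · rintro (x | x)
      · exact hB k
      · exact hA
    · rintro (x | x)
      · exact hA
      · exact hM x
  obtain ⟨C, hC⟩ : ∃ C : Matrix (Fin n) (Fin n) ℝ, A = Cᵀ * C := by
    obtain ⟨c, U, hc, _, hAe⟩ := gx_spectral hA
    refine ⟨of fun a x => Real.sqrt (c a) * U a x, ?_⟩
    rw [hAe]
    ext r s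
    simp only [Matrix.sum_apply, Matrix.smul_apply, vecMulVec_apply, smul_eq_mul, Matrix.mul_apply,
      transpose_apply, of_apply]
    refine sum_congr rfl fun a _ => ?_
    have := Real.mul_self_sqrt (hc a)
    linear_combination (-(U a r * U a s)) * this
  have hdC : A.det = C.det ^ 2 := by rw [hC, det_mul, det_transpose, sq]
  have hCu : IsUnit C.det := by
    rw [isUnit_iff_ne_zero]
    intro h0; apply hdet; rw [hdC, h0]; simp
  set K := C⁻¹ with hK
  have hCK : C * K = 1 := mul_nonsing_inv C hCu
  have hKA : Kᵀ * A * K = 1 := by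
    rw [hC, ← Matrix.mul_assoc, ← transpose_mul, hCK, Matrix.mul_assoc, hCK]; simp
  have hδ : A.det * K.det ^ 2 = 1 := by
    have := congrArg det hCK
    rw [det_mul, det_one] at this
    rw [hdC, ← mul_pow, this, one_pow]
  have hpsd : ∀ X : Matrix (Fin n) (Fin n) ℝ, X.PosSemidef → (Kᵀ * X * K).PosSemidef := by
    intro X hX
    have := hX.conjTranspose_mul_mul_same K
    simpa using this
  have key := gx_main_unit m n i hi (fun k => Kᵀ * B k * K) (fun l => Kᵀ * M l * K)
    (fun k => hpsd _ (hB k)) (fun l => hpsd _ (hM l))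
  have e : Fin n ≃ (Σ k, Fin (i k)) ⊕ Fin (n - ∑ k, i k) :=
    Fintype.equivOfCardEq (by simp; omega)
  have e2 : ∀ k, Fin n ≃ Fin (i k) ⊕ Fin (n - i k) := fun k =>
        Fintype.equivOfCardEq (by have := hik k; simp; omega)
  have h1 : gxPolar (Sum.elim (fun x : (Σ k, Fin (i k)) => Kᵀ * B x.1 * K)
      (fun l => Kᵀ * M l * K)) = K.det ^ 2 *
      gxPolar (Sum.elim (fun x : (Σ k, Fin (i k)) => B x.1) M) := by
    rw [← gx_polar_conj e]
    congr 1
    funext j; rcases j with j | j <;> rfl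
  have h2 : gxPolar (Sum.elim (fun _ : (Σ k, Fin (i k)) => (1 : Matrix (Fin n) (Fin n) ℝ))
      (fun l => Kᵀ * M l * K)) = K.det ^ 2 *
      gxPolar (Sum.elim (fun x : (Σ k, Fin (i k)) => A) M) := by
    rw [← gx_polar_conj e]
    congr 1
    funext j; rcases j with j | j
    · exact hKA.symm
    · rfl
  have h3 : ∀ k, gxPolar (Sum.elim (fun _ : Fin (i k) => Kᵀ * B k * K)
      (fun _ : Fin (n - i k) => (1 : Matrix (Fin n) (Fin n) ℝ))) = K.det ^ 2 *
      gxPolar (Sum.elim (fun _ : Fin (i k) => B k) (fun _ : Fin (n - i k) => A)) := by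
    intro k
    rw [← gx_polar_conj (e2 k)]
    congr 1
    funext j; rcases j with j | j
    · rfl
    · exact hKA.symm
  rw [h1, h2, prod_congr rfl fun k _ => h3 k, prod_mul_distrib, prod_const, card_univ,
    Fintype.card_fin] at key
  have hApos : 0 ≤ A.det := by rw [hdC]; positivity
  have key2 := mul_le_mul_of_nonneg_left key (pow_nonneg hApos (m + 1))
  have hm1 : A.det ^ m * (K.det ^ 2) ^ m = 1 := by rw [← mul_pow, hδ, one_pow]
  generalize gxPolar (Sum.elim (fun x : (Σ k, Fin (i k)) => B x.1) M) = g1 at *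
  generalize gxPolar (Sum.elim (fun x : (Σ k, Fin (i k)) => A) M) = g2 at *
  generalize (∏ k, gxPolar (Sum.elim (fun _ : Fin (i k) => B k)
    (fun _ : Fin (n - i k) => A))) = g3 at *
  generalize (∏ k, ((n - i k).factorial : ℝ)) = q at *
  generalize ((∑ k, i k).factorial : ℝ) = p at *
  calc p * (A.det ^ m * g1) * q = (A.det * K.det ^ 2) * (p * (A.det ^ m * g1) * q) := by
        rw [hδ, one_mul]
    _ = A.det ^ (m + 1) * (p * (K.det ^ 2 * g1) * q) := by ring
    _ ≤ _ := key2
    _ = (A.det ^ m * (K.det ^ 2) ^ m) * (A.det * K.det ^ 2) * (g3 * g2) := by ring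
    _ = g3 * g2 := by rw [hm1, hδ]; ring

lemma gx_list {α : Type*} (n : ℕ) (l : List α) (d : α) (h : l.length = n) :
    (univ : Finset (Fin n)).val.map (fun j : Fin n => l.getD (j : ℕ) d) = (l : Multiset α) := by
  rw [Fin.univ_val_map]
  congr 1
  refine List.ext_getElem (by simp [h]) fun k h1 h2 => ?_
  simp [h2]

lemma gx_map_sum {α J : Type*} [Fintype J] (f : J → α) :
    (univ : Finset J).val.map f = ∑ j, ({f j} : Multiset α) := by
  have h := Multiset.sum_map_singleton ((univ : Finset J).val.map f)
  rw [Multiset.map_map] at h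
  exact h.symm

lemma gx_map_elim {α J K : Type*} [Fintype J] [Fintype K] (f : J → α) (g : K → α) :
    (univ : Finset (J ⊕ K)).val.map (Sum.elim f g) = univ.val.map f + univ.val.map g := by
  simp only [gx_map_sum, Fintype.sum_sum_type, Sum.elim_inl, Sum.elim_inr]

lemma gx_blocks {α : Type*} {m : ℕ} (i : Fin m → ℕ) (B : Fin m → α) :
    (univ : Finset (Σ k, Fin (i k))).val.map (fun x => B x.1) = (blocks i B : Multiset α) := by
  rw [gx_map_sum, Fintype.sum_sigma]
  simp only [sum_const, card_univ, Fintype.card_fin, Multiset.nsmul_singleton]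
  unfold blocks
  rw [← Multiset.coe_join, Multiset.join, ← List.sum_ofFn, List.map_ofFn, Multiset.sum_coe]
  rfl

lemma gx_blocks_length {α : Type*} {m : ℕ} (i : Fin m → ℕ) (B : Fin m → α) :
    (blocks i B).length = ∑ k, i k := by
  have := congrArg Multiset.card (gx_blocks i B)
  simpa using this.symm

theorem generalized_xiao_mixed_discriminant (m n : ℕ) (hm : 1 ≤ m) (hn : 2 ≤ n)
    (i : Fin m → ℕ) (hi : ∑ k, i k ≤ n)
    (A : Matrix (Fin n) (Fin n) ℝ) (B : Fin m → Matrix (Fin n) (Fin n) ℝ)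
    (M : Fin (n - ∑ k, i k) → Matrix (Fin n) (Fin n) ℝ)
    (hA : A.PosSemidef) (hB : ∀ k, (B k).PosSemidef) (hM : ∀ l, (M l).PosSemidef) :
    ((n.factorial : ℝ) /
        (((∏ k, (i k).factorial) * (n - ∑ k, i k).factorial : ℕ) : ℝ)) *
      A.det ^ m *
      mixedDisc (fun j : Fin n => (blocks i B ++ List.ofFn M).getD (j : ℕ) 0) ≤
    (n.choose (∑ k, i k) : ℝ) *
      mixedDisc (fun j : Fin n =>
        (List.ofFn M ++ List.replicate (∑ k, i k) A).getD (j : ℕ) 0) *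
      ∏ k, ((n.choose (i k) : ℝ) *
        mixedDisc (fun j : Fin n => if (j : ℕ) < i k then B k else A)) := by
  have hik : ∀ k, i k ≤ n := fun k =>
    (single_le_sum (f := i) (fun _ _ => Nat.zero_le _) (mem_univ k)).trans hi
  have e1 := gx_mixed_congr (fun j : Fin n => (blocks i B ++ List.ofFn M).getD (j : ℕ) 0)
    (Sum.elim (fun x : (Σ k, Fin (i k)) => B x.1) M) (by
      rw [gx_list _ _ _ (by simp [gx_blocks_length]; omega), gx_map_elim, gx_blocks,
        Fin.univ_val_map]
      rfl)
  have e2 := gx_mixed_congr (fun j : Fin n =>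
        (List.ofFn M ++ List.replicate (∑ k, i k) A).getD (j : ℕ) 0)
    (Sum.elim (fun x : (Σ k, Fin (i k)) => A) M) (by
      rw [gx_list _ _ _ (by simp; omega), gx_map_elim,
        Fin.univ_val_map, add_comm, Multiset.map_const', ← Multiset.coe_add,
        ← Multiset.coe_replicate]
      simp)
  have e3 : ∀ k, mixedDisc (fun j : Fin n => if (j : ℕ) < i k then B k else A) =
      (n.factorial : ℝ)⁻¹ * gxPolar (Sum.elim (fun _ : Fin (i k) => B k)
        (fun _ : Fin (n - i k) => A)) := by
    intro k
    have : (fun j : Fin n => if (j : ℕ) < i k then B k else A) = fun j : Fin n =>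
        (List.replicate (i k) (B k) ++ List.replicate (n - i k) A).getD (j : ℕ) 0 := by
      funext j
      have hj := j.2
      split_ifs with h
      · rw [List.getD_append _ _ _ _ (by simpa using h), List.getD_replicate _ h]
      · rw [List.getD_append_right _ _ _ _ (by simpa using h)]
        rw [List.getD_replicate]
        simp only [List.length_replicate]; omega
    rw [this]
    refine gx_mixed_congr _ _ ?_
    rw [gx_list _ _ _ (by have := hik k; simp; omega), gx_map_elim, Multiset.map_const',
      Multiset.map_const', ← Multiset.coe_add, ← Multiset.coe_replicate, ← Multiset.coe_replicate]
    simp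
  rw [e1, e2]
  simp_rw [e3]
  have key := gx_main m n hm i hi A B M hA hB hM
  have hn0 : (n.factorial : ℝ) ≠ 0 := by positivity
  have hprod : ∏ k, ((n.choose (i k) : ℝ) * ((n.factorial : ℝ)⁻¹ *
      gxPolar (Sum.elim (fun _ : Fin (i k) => B k) (fun _ : Fin (n - i k) => A)))) =
      (∏ k, gxPolar (Sum.elim (fun _ : Fin (i k) => B k) (fun _ : Fin (n - i k) => A))) /
      ((∏ k, ((i k).factorial : ℝ)) * ∏ k, ((n - i k).factorial : ℝ)) := by
    rw [← prod_mul_distrib, ← prod_div_distrib]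
    refine prod_congr rfl fun k _ => ?_
    rw [Nat.cast_choose ℝ (hik k)]
    field_simp
  rw [hprod, Nat.cast_choose ℝ hi]
  push_cast
  have q0 : (0 : ℝ) < ∏ k, ((n - i k).factorial : ℝ) := prod_pos fun k _ => by positivity
  have r0 : (0 : ℝ) < ∏ k, ((i k).factorial : ℝ) := prod_pos fun k _ => by positivity
  have p0 : (0 : ℝ) < ((∑ k, i k).factorial : ℝ) := by positivity
  have s0 : (0 : ℝ) < ((n - ∑ k, i k).factorial : ℝ) := by positivity
  generalize gxPolar (Sum.elim (fun x : (Σ k, Fin (i k)) => B x.1) M) = g1 at *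
  generalize gxPolar (Sum.elim (fun x : (Σ k, Fin (i k)) => A) M) = g2 at *
  generalize (∏ k, gxPolar (Sum.elim (fun _ : Fin (i k) => B k)
    (fun _ : Fin (n - i k) => A))) = g3 at *
  generalize (∏ k, ((n - i k).factorial : ℝ)) = q at *
  generalize (∏ k, ((i k).factorial : ℝ)) = r at *
  generalize ((∑ k, i k).factorial : ℝ) = p at *
  generalize ((n - ∑ k, i k).factorial : ℝ) = s at *
  have hL : (n.factorial : ℝ) / (r * s) * A.det ^ m * ((n.factorial : ℝ)⁻¹ * g1) =
      (p * (A.det ^ m * g1) * q) / (p * q * r * s) := by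
    field_simp
  have hR : (n.factorial : ℝ) / (p * s) * ((n.factorial : ℝ)⁻¹ * g2) * (g3 / (r * q)) =
      (g3 * g2) / (p * q * r * s) := by
    field_simp
  rw [hL, hR]
  exact div_le_div_of_nonneg_right key (by positivity)
end
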